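/- Let g ≥ 1 and let γ be a matrix in the real symplectic group Sp_{2g}(ℝ), written in block form γ = [[A, B], [C, D]] with g×g real blocks. Then for every τ ∈ ℍ_g: (i) the matrix Cτ + D is invertible; (ii) the matrix γ·τ := (Aτ + B)(Cτ + D)^{−1} again lies in ℍ_g (it is symmetric with positive definite imaginary part); (iii) the identity matrix acts trivially, i.e., I_{2g}·τ = τ; and (iv) for γ₁, γ₂ ∈ Sp_{2g}(ℝ), (γ₁γ₂)·τ = γ₁·(γ₂·τ). Thus this formula defines a group action of Sp_{2g}(ℝ) on ℍ_g. -/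

import Mathlib

open Matrix

noncomputable section

/-- The Siegel upper half space `ℍ_g`: symmetric `g × g` complex matrices whose
entrywise imaginary part is a positive definite real matrix. -/
def SiegelUpperHalfSpace (g : ℕ) : Set (Matrix (Fin g) (Fin g) ℂ) :=
  {τ | τ.IsSymm ∧ (Matrix.of fun i j => (τ i j).im).PosDef}

/-- The standard symplectic form matrix `J = [[0, I], [-I, 0]]`. -/
def Jmat (g : ℕ) : Matrix (Fin g ⊕ Fin g) (Fin g ⊕ Fin g) ℝ :=
  Matrix.fromBlocks 0 1 (-1) 0

/-- Membership in the real symplectic group `Sp_{2g}(ℝ)`: `Mᵀ J M = J`. -/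
def IsSymplectic {g : ℕ} (M : Matrix (Fin g ⊕ Fin g) (Fin g ⊕ Fin g) ℝ) : Prop :=
  Mᵀ * Jmat g * M = Jmat g

/-- The action `γ·τ = (Aτ + B)(Cτ + D)⁻¹` of a `2g × 2g` real matrix, written in block
form `γ = [[A, B], [C, D]]`, on a `g × g` complex matrix. -/
def siegelAct {g : ℕ} (M : Matrix (Fin g ⊕ Fin g) (Fin g ⊕ Fin g) ℝ)
    (τ : Matrix (Fin g) (Fin g) ℂ) : Matrix (Fin g) (Fin g) ℂ :=
  (M.toBlocks₁₁.map (Complex.ofReal) * τ + M.toBlocks₁₂.map (Complex.ofReal)) *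
    (M.toBlocks₂₁.map (Complex.ofReal) * τ + M.toBlocks₂₂.map (Complex.ofReal))⁻¹

open scoped ComplexOrder in
lemma siegel_posDef_map {g : ℕ} (Y : Matrix (Fin g) (Fin g) ℝ) :
    (Y.map Complex.ofReal).PosDef ↔ Y.PosDef := by
  have key : ∀ u v : Fin g → ℝ, Y.IsSymm →
      star (fun i => (u i : ℂ) + v i * Complex.I) ⬝ᵥ
        (Y.map Complex.ofReal *ᵥ (fun i => (u i : ℂ) + v i * Complex.I)) =
      ((u ⬝ᵥ (Y *ᵥ u) + v ⬝ᵥ (Y *ᵥ v) : ℝ) : ℂ) := by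
    intro u v hY
    have hsym : u ⬝ᵥ (Y *ᵥ v) = v ⬝ᵥ (Y *ᵥ u) := by
      rw [dotProduct_mulVec, ← mulVec_transpose, hY.eq, dotProduct_comm]
    have h1 : Y.map Complex.ofReal *ᵥ (fun i => (u i : ℂ) + v i * Complex.I) =
        fun i => (((Y *ᵥ u) i : ℝ) : ℂ) + (((Y *ᵥ v) i : ℝ) : ℂ) * Complex.I := by
      funext i
      simp only [mulVec, dotProduct, Matrix.map_apply, Complex.ofReal_sum, Complex.ofReal_mul,
        Finset.sum_mul, ← Finset.sum_add_distrib]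
      exact Finset.sum_congr rfl fun j _ => by ring
    rw [h1]
    generalize Y *ᵥ u = a at *
    generalize Y *ᵥ v = b at *
    apply Complex.ext
    · simp [dotProduct, Finset.sum_add_distrib]
    · simp only [dotProduct] at hsym
      simp [dotProduct, Finset.sum_add_distrib, hsym]
  constructor
  · intro h
    have hs : Y.IsSymm := by
      have := h.isHermitian
      ext i j
      have := congrFun (congrFun this i) j
      simpa using this
    refine PosDef.of_dotProduct_mulVec_pos (by simpa [IsHermitian, conjTranspose_eq_transpose_of_trivial] using hs.eq) ?_
    intro x hx
    have := h.dotProduct_mulVec_pos (x := fun i => (x i : ℂ) + ((0 : Fin g → ℝ) i : ℝ) * Complex.I)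
      (by
        intro h0
        apply hx
        funext i
        simpa using congrFun h0 i)
    rw [key x 0 hs] at this
    have h2 := Complex.zero_lt_real.mp this
    simpa using h2
  · intro h
    have hs : Y.IsSymm := by
      simpa [IsHermitian, Matrix.IsSymm, conjTranspose_eq_transpose_of_trivial] using h.isHermitian
    refine PosDef.of_dotProduct_mulVec_pos ?_ ?_
    · ext i j
      simpa using hs.apply i j
    · intro x hx
      have hxe : x = fun i => (((x i).re : ℝ) : ℂ) + (((x i).im : ℝ) : ℂ) * Complex.I := by
        funext i
        simp [Complex.re_add_im]
      rw [hxe, key (fun i => (x i).re) (fun i => (x i).im) hs]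
      apply Complex.zero_lt_real.mpr
      have n1 : ∀ w, 0 ≤ w ⬝ᵥ (Y *ᵥ w) := fun w => by
        simpa using h.posSemidef.dotProduct_mulVec_nonneg w
      by_cases hu : (fun i => (x i).re) = 0
      · have hv : (fun i => (x i).im) ≠ 0 := by
          intro hv
          apply hx
          funext i
          exact Complex.ext (congrFun hu i) (congrFun hv i)
        have := h.dotProduct_mulVec_pos hv
        simp only [star_trivial] at this
        linarith [n1 (fun i => (x i).re)]
      · have := h.dotProduct_mulVec_pos hu
        simp only [star_trivial] at this
        linarith [n1 (fun i => (x i).im)]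

lemma siegel_sub_conj {g : ℕ} {τ : Matrix (Fin g) (Fin g) ℂ} (h : τ.IsSymm) :
    τ - τᴴ = (2 * Complex.I) • (Matrix.of fun i j => (τ i j).im).map Complex.ofReal := by
  ext i j
  have := h.apply i j
  simp only [Matrix.sub_apply, conjTranspose_apply, this, Matrix.smul_apply, Matrix.map_apply,
    Matrix.of_apply, smul_eq_mul]
  apply Complex.ext <;> simp
  ring

lemma siegel_rel {g : ℕ} {M : Matrix (Fin g ⊕ Fin g) (Fin g ⊕ Fin g) ℝ} (h : IsSymplectic M) :
    M.toBlocks₁₁ᵀ * M.toBlocks₂₁ = M.toBlocks₂₁ᵀ * M.toBlocks₁₁ ∧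
    M.toBlocks₁₂ᵀ * M.toBlocks₂₂ = M.toBlocks₂₂ᵀ * M.toBlocks₁₂ ∧
    M.toBlocks₁₁ᵀ * M.toBlocks₂₂ = 1 + M.toBlocks₂₁ᵀ * M.toBlocks₁₂ ∧
    M.toBlocks₂₂ᵀ * M.toBlocks₁₁ = 1 + M.toBlocks₁₂ᵀ * M.toBlocks₂₁ := by
  unfold IsSymplectic Jmat at h
  rw [← fromBlocks_toBlocks M] at h
  simp only [fromBlocks_transpose, fromBlocks_multiply, fromBlocks_inj] at h
  obtain ⟨h1, h2, h3, h4⟩ := h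
  simp only [Matrix.mul_zero, Matrix.mul_one, Matrix.mul_neg, zero_add, add_zero,
    Matrix.neg_mul] at h1 h2 h3 h4
  refine ⟨?_, ?_, ?_, ?_⟩
  · rw [← sub_eq_zero, ← h1]; abel
  · rw [← sub_eq_zero, ← h4]; abel
  · rw [← h2]; abel
  · rw [← neg_inj, neg_add, ← h3]; abel

open scoped ComplexOrder in
lemma siegel_core {g : ℕ} {τ : Matrix (Fin g) (Fin g) ℂ} (hτ : τ ∈ SiegelUpperHalfSpace g)
    {M : Matrix (Fin g ⊕ Fin g) (Fin g ⊕ Fin g) ℝ} (hM : IsSymplectic M) :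
    IsUnit (M.toBlocks₂₁.map (Complex.ofReal) * τ + M.toBlocks₂₂.map (Complex.ofReal)) ∧
        siegelAct M τ ∈ SiegelUpperHalfSpace g := by
  obtain ⟨hs, hp⟩ := hτ
  have hsub := siegel_sub_conj hs
  rw [← siegel_posDef_map] at hp
  set Y := (Matrix.of fun i j => (τ i j).im).map Complex.ofReal with hY
  obtain ⟨r1, r2, r3, r4⟩ := siegel_rel hM
  unfold siegelAct
  have mm : ∀ X Z : Matrix (Fin g) (Fin g) ℝ,
      (X * Z).map Complex.ofReal = X.map Complex.ofReal * Z.map Complex.ofReal :=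
    fun X Z => Matrix.map_mul (f := Complex.ofRealHom)
  have ma : ∀ X Z : Matrix (Fin g) (Fin g) ℝ,
      (X + Z).map Complex.ofReal = X.map Complex.ofReal + Z.map Complex.ofReal :=
    fun X Z => Matrix.map_add _ (by simp) X Z
  have m1 : (1 : Matrix (Fin g) (Fin g) ℝ).map Complex.ofReal = 1 :=
    Matrix.map_one _ (by simp) (by simp)
  have mt : ∀ X : Matrix (Fin g) (Fin g) ℝ,
      Xᵀ.map Complex.ofReal = (X.map Complex.ofReal)ᵀ := fun X => rfl
  have mh : ∀ X : Matrix (Fin g) (Fin g) ℝ,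
      (X.map Complex.ofReal)ᴴ = (X.map Complex.ofReal)ᵀ := fun X => by
    ext i j; simp
  replace r1 := congrArg (fun X => X.map Complex.ofReal) r1
  replace r2 := congrArg (fun X => X.map Complex.ofReal) r2
  replace r3 := congrArg (fun X => X.map Complex.ofReal) r3
  replace r4 := congrArg (fun X => X.map Complex.ofReal) r4
  simp only [mm, ma, m1, mt] at r1 r2 r3 r4
  have hA := mh M.toBlocks₁₁
  have hB := mh M.toBlocks₁₂
  have hC := mh M.toBlocks₂₁
  have hD := mh M.toBlocks₂₂
  generalize M.toBlocks₁₁.map Complex.ofReal = A at *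
  generalize M.toBlocks₁₂.map Complex.ofReal = B at *
  generalize M.toBlocks₂₁.map Complex.ofReal = C at *
  generalize M.toBlocks₂₂.map Complex.ofReal = D at *
  have gen : ∀ σ : Matrix (Fin g) (Fin g) ℂ,
      (σ * Cᵀ + Dᵀ) * (A * τ + B) - (σ * Aᵀ + Bᵀ) * (C * τ + D) = τ - σ := by
    intro σ
    have : (σ * Cᵀ + Dᵀ) * (A * τ + B) - (σ * Aᵀ + Bᵀ) * (C * τ + D) =
        σ * (Cᵀ * A) * τ - σ * (Aᵀ * C) * τ + (Dᵀ * A - Bᵀ * C) * τ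
          - σ * (Aᵀ * D - Cᵀ * B) + (Dᵀ * B - Bᵀ * D) := by noncomm_ring
    rw [this, r1, r2, r3, r4]
    noncomm_ring
  have hPs := gen τ
  have hPh := gen τᴴ
  have eP : (A * τ + B)ᵀ = τ * Aᵀ + Bᵀ := by simp [hs.eq]
  have eQ : (C * τ + D)ᵀ = τ * Cᵀ + Dᵀ := by simp [hs.eq]
  have fP : (A * τ + B)ᴴ = τᴴ * Aᵀ + Bᵀ := by simp [hA, hB]
  have fQ : (C * τ + D)ᴴ = τᴴ * Cᵀ + Dᵀ := by simp [hC, hD]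
  rw [← eP, ← eQ, sub_self, sub_eq_zero] at hPs
  rw [← fP, ← fQ, hsub] at hPh
  generalize A * τ + B = P at *
  generalize C * τ + D = Q at *
  have h2I : (2 * Complex.I) ≠ 0 := by simp
  have hQ : IsUnit Q := by
    rw [← Matrix.mulVec_injective_iff_isUnit]
    refine (injective_iff_map_eq_zero (Matrix.mulVecLin Q)).mpr ?_
    intro v hv
    rw [mulVecLin_apply] at hv
    by_contra hne
    have hpos := hp.dotProduct_mulVec_pos hne
    have e := congrArg (fun X => star v ⬝ᵥ (X *ᵥ v)) hPh
    simp only [sub_mulVec, ← mulVec_mulVec, hv, mulVec_zero, sub_zero, smul_mulVec,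
      dotProduct_smul] at e
    rw [dotProduct_mulVec, ← star_mulVec, hv, star_zero, zero_dotProduct] at e
    rcases smul_eq_zero.mp e.symm with h | h
    · exact h2I h
    · exact hpos.ne' h
  have hd : IsUnit Q.det := (Matrix.isUnit_iff_isUnit_det Q).mp hQ
  have hdT : IsUnit Qᵀ.det := by rwa [det_transpose]
  have hdH : IsUnit Qᴴ.det := by rw [det_conjTranspose]; exact hd.star
  have hW : (P * Q⁻¹).IsSymm := by
    unfold Matrix.IsSymm
    rw [transpose_mul, transpose_nonsing_inv]
    calc Qᵀ⁻¹ * Pᵀ = Qᵀ⁻¹ * (Pᵀ * Q) * Q⁻¹ := by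
          rw [Matrix.mul_assoc, Matrix.mul_assoc, mul_nonsing_inv _ hd, Matrix.mul_one]
      _ = P * Q⁻¹ := by
          rw [← hPs, ← Matrix.mul_assoc, nonsing_inv_mul _ hdT, Matrix.one_mul]
  refine ⟨hQ, hW, ?_⟩
  rw [← siegel_posDef_map]
  have e : P * Q⁻¹ - (P * Q⁻¹)ᴴ = (2 * Complex.I) • ((Q⁻¹)ᴴ * Y * Q⁻¹) := by
    have : (Q⁻¹)ᴴ * ((2 * Complex.I) • Y) * Q⁻¹ = (2 * Complex.I) • ((Q⁻¹)ᴴ * Y * Q⁻¹) := by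
      simp
    rw [← this, ← hPh, conjTranspose_mul, conjTranspose_nonsing_inv]
    rw [Matrix.mul_sub, Matrix.sub_mul, ← Matrix.mul_assoc, nonsing_inv_mul _ hdH,
      Matrix.one_mul]
    congr 1
    rw [Matrix.mul_assoc, Matrix.mul_assoc, mul_nonsing_inv _ hd, Matrix.mul_one]
  rw [siegel_sub_conj hW] at e
  rw [smul_right_injective _ h2I e]
  refine hp.conjTranspose_mul_mul_same ?_
  rw [Matrix.mulVec_injective_iff_isUnit]
  exact (Matrix.isUnit_nonsing_inv_iff).mpr hQ

/-- `Sp_{2g}(ℝ)` acts on the Siegel upper half space by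
`[[A,B],[C,D]]·τ = (Aτ + B)(Cτ + D)⁻¹`. -/
theorem symplectic_action_on_siegel (g : ℕ) (hg : 1 ≤ g) :
    (∀ τ ∈ SiegelUpperHalfSpace g,
      ∀ M : Matrix (Fin g ⊕ Fin g) (Fin g ⊕ Fin g) ℝ, IsSymplectic M →
        -- (i) `Cτ + D` is invertible
        IsUnit (M.toBlocks₂₁.map (Complex.ofReal) * τ + M.toBlocks₂₂.map (Complex.ofReal)) ∧
        -- (ii) `γ·τ` again lies in `ℍ_g`
        siegelAct M τ ∈ SiegelUpperHalfSpace g) ∧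
    -- (iii) the identity acts trivially
    (∀ τ ∈ SiegelUpperHalfSpace g,
      siegelAct (1 : Matrix (Fin g ⊕ Fin g) (Fin g ⊕ Fin g) ℝ) τ = τ) ∧
    -- (iv) compatibility with multiplication
    (∀ τ ∈ SiegelUpperHalfSpace g,
      ∀ M₁ M₂ : Matrix (Fin g ⊕ Fin g) (Fin g ⊕ Fin g) ℝ,
        IsSymplectic M₁ → IsSymplectic M₂ →
          siegelAct (M₁ * M₂) τ = siegelAct M₁ (siegelAct M₂ τ)) := by
  refine ⟨fun τ hτ M hM => siegel_core hτ hM, ?_, ?_⟩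
  · intro τ _
    have h := fromBlocks_one (l := Fin g) (m := Fin g) (α := ℝ)
    rw [← h]
    simp only [siegelAct, toBlocks_fromBlocks₁₁, toBlocks_fromBlocks₁₂, toBlocks_fromBlocks₂₁,
      toBlocks_fromBlocks₂₂]
    simp
  · intro τ hτ M₁ M₂ h₁ h₂
    obtain ⟨hQ, -⟩ := siegel_core hτ h₂
    have mm : ∀ X Z : Matrix (Fin g) (Fin g) ℝ,
        (X * Z).map Complex.ofReal = X.map Complex.ofReal * Z.map Complex.ofReal :=
      fun X Z => Matrix.map_mul (f := Complex.ofRealHom)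
    have ma : ∀ X Z : Matrix (Fin g) (Fin g) ℝ,
        (X + Z).map Complex.ofReal = X.map Complex.ofReal + Z.map Complex.ofReal :=
      fun X Z => Matrix.map_add _ (by simp) X Z
    have hb := fromBlocks_multiply M₁.toBlocks₁₁ M₁.toBlocks₁₂ M₁.toBlocks₂₁ M₁.toBlocks₂₂
      M₂.toBlocks₁₁ M₂.toBlocks₁₂ M₂.toBlocks₂₁ M₂.toBlocks₂₂
    rw [fromBlocks_toBlocks, fromBlocks_toBlocks] at hb
    unfold siegelAct
    rw [hb]
    simp only [toBlocks_fromBlocks₁₁, toBlocks_fromBlocks₁₂, toBlocks_fromBlocks₂₁,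
      toBlocks_fromBlocks₂₂, mm, ma]
    generalize M₁.toBlocks₁₁.map Complex.ofReal = A₁ at *
    generalize M₁.toBlocks₁₂.map Complex.ofReal = B₁ at *
    generalize M₁.toBlocks₂₁.map Complex.ofReal = C₁ at *
    generalize M₁.toBlocks₂₂.map Complex.ofReal = D₁ at *
    generalize M₂.toBlocks₁₁.map Complex.ofReal = A at *
    generalize M₂.toBlocks₁₂.map Complex.ofReal = B at *
    generalize M₂.toBlocks₂₁.map Complex.ofReal = C at *
    generalize M₂.toBlocks₂₂.map Complex.ofReal = D at *
    have key : ∀ X Z : Matrix (Fin g) (Fin g) ℂ,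
        (X * A + Z * C) * τ + (X * B + Z * D) =
          (X * ((A * τ + B) * (C * τ + D)⁻¹) + Z) * (C * τ + D) := by
      intro X Z
      rw [Matrix.add_mul (X * ((A * τ + B) * (C * τ + D)⁻¹)),
        Matrix.mul_assoc X ((A * τ + B) * (C * τ + D)⁻¹), Matrix.mul_assoc (A * τ + B),
        nonsing_inv_mul _ ((Matrix.isUnit_iff_isUnit_det _).mp hQ)]
      noncomm_ring
    rw [key, key, Matrix.mul_inv_rev]
    rw [Matrix.mul_assoc, ← Matrix.mul_assoc (C * τ + D),
      mul_nonsing_inv _ ((Matrix.isUnit_iff_isUnit_det _).mp hQ), Matrix.one_mul]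

end
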